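/- (First ⁴φ³ identity of Andrews and Li–Chu) Let n be a nonnegative integer, let p be a nonzero complex number and set q = p², and let b, d be complex numbers with b ≠ 0 such that (q;q)_n ≠ 0, (dq;q)_n ≠ 0, (dp;q)_n ≠ 0, (b²;q)_n ≠ 0, (−b;p)_n ≠ 0, (d;p)_n ≠ 0, and 1 − d q^n ≠ 0. Then ∑_{j=0}^{n} ((q^{-n};q)_j (b;q)_j (bp;q)_j (d²q^n;q)_j / ((q;q)_j (dq;q)_j (dp;q)_j (b²;q)_j)) · q^j = b^n (1−d) (−p;p)_n (dp/b;p)_n / ((1 − d q^n)(−b;p)_n (d;p)_n). -/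

import Mathlib

/-- The $q$-shifted factorial $(a;q)_m = \prod_{k=0}^{m-1}(1 - a q^k)$. -/
noncomputable def qPoch (q a : ℂ) (m : ℕ) : ℂ := ∏ k ∈ Finset.range m, (1 - a * q ^ k)

theorem qPoch_add (q a : ℂ) (m n : ℕ) :
    qPoch q a (m + n) = qPoch q a m * qPoch q (a * q ^ m) n := by
  simp only [qPoch, Finset.prod_range_add, pow_add, mul_assoc]

theorem qPoch_succ (q a : ℂ) (m : ℕ) :
    qPoch q a (m + 1) = qPoch q a m * (1 - a * q ^ m) := Finset.prod_range_succ _ _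

theorem qPoch_succ' (q a : ℂ) (m : ℕ) :
    qPoch q a (m + 1) = (1 - a) * qPoch q (a * q) m := by
  rw [add_comm, qPoch_add]
  simp [qPoch]

theorem qPoch_sq (p a : ℂ) (m : ℕ) :
    qPoch (p ^ 2) (a ^ 2) m = qPoch p a m * qPoch p (-a) m := by
  simp only [qPoch, ← Finset.prod_mul_distrib]
  exact Finset.prod_congr rfl fun k _ => by ring

theorem qPoch_two_mul (p a : ℂ) (m : ℕ) :
    qPoch p a (2 * m) = qPoch (p ^ 2) a m * qPoch (p ^ 2) (a * p) m := by
  induction m with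
  | zero => simp [qPoch]
  | succ m ih =>
    rw [show 2 * (m + 1) = 2 * m + 1 + 1 by ring, qPoch_succ, qPoch_succ, ih, qPoch_succ,
      qPoch_succ]
    ring

theorem qPoch_ne_zero_iff {q a : ℂ} {m : ℕ} :
    qPoch q a m ≠ 0 ↔ ∀ k < m, a * q ^ k ≠ 1 := by
  simp [qPoch, Finset.prod_eq_zero_iff, sub_eq_zero, @eq_comm _ (1 : ℂ)]

theorem qPoch_ne_zero_of_le {q a : ℂ} {m n : ℕ} (h : qPoch q a n ≠ 0) (hmn : m ≤ n) :
    qPoch q a m ≠ 0 :=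
  qPoch_ne_zero_iff.2 fun k hk => qPoch_ne_zero_iff.1 h k (hk.trans_le hmn)

/-- Shifting the parameter and shifting the index of a quotient of `q`-shifted factorials. -/
theorem qPoch_mul_qPoch_comm (q a : ℂ) (m n : ℕ) :
    qPoch q a m * qPoch q (a * q ^ m) n = qPoch q a n * qPoch q (a * q ^ n) m := by
  rw [← qPoch_add, ← qPoch_add, add_comm]

theorem qPoch_zpow_neg_self {q : ℂ} (hq : q ≠ 0) (n : ℕ) :
    qPoch q (q ^ (-(n : ℤ))) n = qPoch q q n * ∏ k ∈ Finset.range n, (-(q ^ (k + 1))⁻¹) := by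
  simp only [qPoch, ← Finset.prod_mul_distrib]
  rw [← Finset.prod_range_reflect]
  refine Finset.prod_congr rfl fun k hk => ?_
  have hk : k < n := Finset.mem_range.1 hk
  obtain ⟨m, rfl⟩ : ∃ m, n = m + k + 1 := ⟨n - k - 1, by omega⟩
  rw [show m + k + 1 - 1 - k = m by omega, zpow_neg, zpow_natCast]
  field_simp
  ring

/-- The terminating `q`-binomial theorem. -/
theorem sum_qPoch_div_mul_pow {q : ℂ} (hq : q ≠ 0) (z : ℂ) (n : ℕ) (hn : qPoch q q n ≠ 0) :
    ∑ j ∈ Finset.range (n + 1), qPoch q (q ^ (-(n : ℤ))) j / qPoch q q j * z ^ j =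
      ∏ i ∈ Finset.range n, (1 - z * (q ^ (i + 1))⁻¹) := by
  induction n with
  | zero => simp [qPoch]
  | succ n ih =>
    have hz : qPoch q (q ^ (-(n : ℤ))) (n + 1) = 0 := by
      rw [qPoch_succ, zpow_neg, zpow_natCast, inv_mul_cancel₀ (pow_ne_zero _ hq)]
      ring
    rw [Finset.prod_range_succ, ← ih (qPoch_ne_zero_of_le hn n.le_succ), mul_sub, mul_one]
    have hext : ∑ j ∈ Finset.range (n + 1), qPoch q (q ^ (-(n : ℤ))) j / qPoch q q j * z ^ j =
        ∑ j ∈ Finset.range (n + 2), qPoch q (q ^ (-(n : ℤ))) j / qPoch q q j * z ^ j := by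
      rw [Finset.sum_range_succ _ (n + 1), hz]
      simp
    conv_rhs => enter [1]; rw [hext]
    rw [Finset.sum_range_succ', Finset.sum_range_succ' _ (n + 1), add_sub_right_comm,
      Finset.sum_mul, ← Finset.sum_sub_distrib]
    congr 1
    refine Finset.sum_congr rfl fun j hj => ?_
    have hj : j + 1 ≤ n + 1 := by simpa [Nat.lt_succ_iff] using hj
    have h1 := qPoch_ne_zero_of_le hn hj
    rw [qPoch_succ] at h1
    have h2 := left_ne_zero_of_mul h1
    have h3 := right_ne_zero_of_mul h1
    rw [qPoch_succ' q (q ^ (-((n + 1 : ℕ) : ℤ))), qPoch_succ, qPoch_succ]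
    have h4 : q ^ (-((n + 1 : ℕ) : ℤ)) * q = q ^ (-(n : ℤ)) := by
      rw [← zpow_add_one₀ hq]
      congr 1
      push_cast
      ring
    rw [h4, ← h4, zpow_neg, zpow_natCast]
    field_simp
    ring

/-- Polynomials of degree less than `n` are annihilated by the `n`-th `q`-difference. -/
theorem sum_qPoch_div_mul_eval_eq_zero {q : ℂ} (hq : q ≠ 0) {n : ℕ} (hn : qPoch q q n ≠ 0)
    (P : Polynomial ℂ) (hP : P.natDegree < n) :
    ∑ j ∈ Finset.range (n + 1),
      qPoch q (q ^ (-(n : ℤ))) j / qPoch q q j * q ^ j * P.eval (q ^ j) = 0 := by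
  simp only [Polynomial.eval_eq_sum_range' hP, Finset.mul_sum]
  rw [Finset.sum_comm]
  refine Finset.sum_eq_zero fun i hi => ?_
  have h := sum_qPoch_div_mul_pow hq (q ^ (i + 1)) n hn
  rw [Finset.prod_eq_zero hi (by rw [mul_inv_cancel₀ (pow_ne_zero _ hq), sub_self])] at h
  rw [← mul_zero (P.coeff i), ← h, Finset.mul_sum]
  exact Finset.sum_congr rfl fun j _ => by ring

theorem natDegree_prod_one_sub_C_mul_X_le (c : ℕ → ℂ) (m : ℕ) :
    (∏ i ∈ Finset.range m, (1 - Polynomial.C (c i) * Polynomial.X)).natDegree ≤ m := by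
  refine (Polynomial.natDegree_prod_le _ _).trans ?_
  refine (Finset.sum_le_card_nsmul _ _ 1 fun i _ => ?_).trans (by simp)
  compute_degree

theorem qPoch_sq_div_mul_pow_self {p : ℂ} (hp : p ≠ 0) (n : ℕ) (hn : qPoch (p ^ 2) (p ^ 2) n ≠ 0) :
    qPoch (p ^ 2) ((p ^ 2) ^ (-(n : ℤ))) n / qPoch (p ^ 2) (p ^ 2) n * (p ^ 2) ^ n =
      (-p / p ^ n) ^ n := by
  rw [qPoch_zpow_neg_self (pow_ne_zero 2 hp), mul_div_cancel_left₀ _ hn]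
  have h : ∀ m : ℕ, ∏ k ∈ Finset.range m, (-((p ^ 2) ^ (k + 1))⁻¹) =
      (-1) ^ m * (p ^ (m * m + m))⁻¹ := by
    intro m
    induction m with
    | zero => simp
    | succ m ih =>
      rw [Finset.prod_range_succ, ih]
      field_simp
      ring
  rw [h, div_pow, neg_pow p]
  field_simp
  ring

/-- The summand of the identity after clearing the denominators that involve `b` and `d`. -/
noncomputable def clearedSummand (n : ℕ) (p b d : ℂ) (j : ℕ) : ℂ :=
  qPoch (p ^ 2) ((p ^ 2) ^ (-(n : ℤ))) j / qPoch (p ^ 2) (p ^ 2) j * (p ^ 2) ^ j *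
    (qPoch (p ^ 2) (d ^ 2 * (p ^ 2) ^ n) j * qPoch p (d * p * p ^ (2 * j)) (2 * (n - j)) *
      (qPoch p (b * p ^ j) j * qPoch p (-b * p ^ j) (n - j)))

theorem qPoch_sq_mul_shifted (p b : ℂ) {n j : ℕ} (hj : j ≤ n) :
    qPoch (p ^ 2) (b ^ 2) j * (qPoch p (b * p ^ j) j * qPoch p (-b * p ^ j) (n - j)) =
      qPoch p b (2 * j) * qPoch p (-b) n := by
  obtain ⟨m, rfl⟩ := Nat.exists_eq_add_of_le hj
  rw [qPoch_sq, two_mul, qPoch_add, qPoch_add, Nat.add_sub_cancel_left]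
  ring

/-- At the nodes `b = d p ^ k` the cleared sum vanishes. -/
theorem sum_clearedSummand_eq_zero {n : ℕ} {p d : ℂ} (hp : p ≠ 0)
    (hn : qPoch (p ^ 2) (p ^ 2) n ≠ 0) (hd : qPoch (p ^ 2) (d ^ 2) (2 * n + 1) ≠ 0)
    {k : ℕ} (hk : k < n) :
    ∑ j ∈ Finset.range (n + 1), clearedSummand n p (d * p ^ (k + 1)) d j = 0 := by
  obtain ⟨m, rfl⟩ : ∃ m, n = m + (k + 1) := ⟨n - (k + 1), by omega⟩
  set n := m + (k + 1) with hn_def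
  have hd' : qPoch p d (2 * n + 1) ≠ 0 := by
    rw [qPoch_sq] at hd
    exact left_ne_zero_of_mul hd
  rw [qPoch_succ'] at hd'
  have hdp : qPoch p (d * p) (2 * n) ≠ 0 := right_ne_zero_of_mul hd'
  have hdq (i : ℕ) (hi : k + 1 + i ≤ 2 * n + 1) :
      qPoch (p ^ 2) (d ^ 2 * (p ^ 2) ^ (k + 1)) i ≠ 0 := by
    have h := qPoch_ne_zero_of_le hd hi
    rw [qPoch_add] at h
    exact right_ne_zero_of_mul h
  let P : Polynomial ℂ :=
    (∏ i ∈ Finset.range m,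
      (1 - Polynomial.C (d ^ 2 * (p ^ 2) ^ (k + 1) * (p ^ 2) ^ i) * Polynomial.X)) *
    ∏ i ∈ Finset.range k, (1 - Polynomial.C (d * p * p ^ i) * Polynomial.X)
  have hPdeg : P.natDegree < n := by
    refine (Polynomial.natDegree_mul_le.trans (add_le_add
      (natDegree_prod_one_sub_C_mul_X_le _ _) (natDegree_prod_one_sub_C_mul_X_le _ _))).trans_lt ?_
    omega
  have hPeval (j : ℕ) : P.eval ((p ^ 2) ^ j) =
      qPoch (p ^ 2) (d ^ 2 * (p ^ 2) ^ (k + 1) * (p ^ 2) ^ j) m *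
        qPoch p (d * p * p ^ (2 * j)) k := by
    simp only [P, Polynomial.eval_mul, Polynomial.eval_prod, Polynomial.eval_sub,
      Polynomial.eval_one, Polynomial.eval_C, Polynomial.eval_X, qPoch]
    congr 1 <;> exact Finset.prod_congr rfl fun i _ => by ring
  have hk1 := hdq m (by omega)
  have hk2 : qPoch p (d * p) k ≠ 0 := qPoch_ne_zero_of_le hdp (by omega)
  have key : ∀ j ∈ Finset.range (n + 1), clearedSummand n p (d * p ^ (k + 1)) d j =
      qPoch p (-(d * p ^ (k + 1))) n * qPoch p (d * p) (2 * n) /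
        (qPoch (p ^ 2) (d ^ 2 * (p ^ 2) ^ (k + 1)) m * qPoch p (d * p) k) *
      (qPoch (p ^ 2) ((p ^ 2) ^ (-(n : ℤ))) j / qPoch (p ^ 2) (p ^ 2) j * (p ^ 2) ^ j *
        P.eval ((p ^ 2) ^ j)) := by
    intro j hj
    have hj : j ≤ n := by simpa [Nat.lt_succ_iff] using hj
    have e1 := qPoch_sq_mul_shifted p (d * p ^ (k + 1)) hj
    rw [show (d * p ^ (k + 1)) ^ 2 = d ^ 2 * (p ^ 2) ^ (k + 1) by ring] at e1
    have e2 := qPoch_mul_qPoch_comm (p ^ 2) (d ^ 2 * (p ^ 2) ^ (k + 1)) m j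
    rw [show d ^ 2 * (p ^ 2) ^ (k + 1) * (p ^ 2) ^ m = d ^ 2 * (p ^ 2) ^ n by
      rw [hn_def]; ring] at e2
    have e3 := qPoch_mul_qPoch_comm p (d * p) k (2 * j)
    rw [show d * p * p ^ k = d * p ^ (k + 1) by ring] at e3
    have e4 := qPoch_add p (d * p) (2 * j) (2 * (n - j))
    rw [show 2 * j + 2 * (n - j) = 2 * n by omega] at e4
    have hj1 := hdq j (by omega)
    rw [hPeval, clearedSummand, e4]
    generalize qPoch (p ^ 2) ((p ^ 2) ^ (-(n : ℤ))) j / qPoch (p ^ 2) (p ^ 2) j * (p ^ 2) ^ j = c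
    rw [div_mul_eq_mul_div, eq_div_iff (mul_ne_zero hk1 hk2)]
    refine mul_left_cancel₀ hj1 ?_
    generalize qPoch (p ^ 2) (d ^ 2 * (p ^ 2) ^ (k + 1)) j = x1 at *
    generalize qPoch p (d * p ^ (k + 1) * p ^ j) j *
      qPoch p (-(d * p ^ (k + 1)) * p ^ j) (n - j) = x2 at *
    generalize qPoch (p ^ 2) (d ^ 2 * (p ^ 2) ^ (k + 1)) m = x3 at *
    generalize qPoch (p ^ 2) (d ^ 2 * (p ^ 2) ^ n) j = x4 at *
    generalize qPoch p (d * p) k = x5 at *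
    generalize qPoch p (d * p * p ^ (2 * j)) (2 * (n - j)) = x6 at *
    generalize qPoch p (d * p ^ (k + 1)) (2 * j) = x7 at *
    linear_combination c * x3 * x4 * x5 * x6 * e1 +
      c * x6 * x5 * x7 * qPoch p (-(d * p ^ (k + 1))) n * e2 +
      c * x6 * x1 * qPoch p (-(d * p ^ (k + 1))) n *
        qPoch (p ^ 2) (d ^ 2 * (p ^ 2) ^ (k + 1) * (p ^ 2) ^ j) m * e3
  rw [Finset.sum_congr rfl key, ← Finset.mul_sum,
    sum_qPoch_div_mul_eval_eq_zero (pow_ne_zero 2 hp) hn P hPdeg, mul_zero]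

/-- At the node `b = -p ^ (1 - n)` only the last summand survives. -/
theorem sum_clearedSummand_neg_div_pow {n : ℕ} {p : ℂ} (d : ℂ) (hp : p ≠ 0)
    (hn : qPoch (p ^ 2) (p ^ 2) n ≠ 0) :
    ∑ j ∈ Finset.range (n + 1), clearedSummand n p (-p / p ^ n) d j =
      qPoch p (-p) n * qPoch p (d * p ^ n) n *
        ∏ k ∈ Finset.range n, (-p / p ^ n - d * p ^ (k + 1)) := by
  have hlast : ∀ j ∈ Finset.range n, clearedSummand n p (-p / p ^ n) d j = 0 := by
    intro j hj
    have hj : j < n := Finset.mem_range.1 hj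
    obtain ⟨m, rfl⟩ : ∃ m, n = j + (m + 1) := ⟨n - (j + 1), by omega⟩
    have : qPoch p (-(-p / p ^ (j + (m + 1))) * p ^ j) (m + 1) = 0 := by
      rw [qPoch_succ]
      refine mul_eq_zero_of_right _ ?_
      field_simp
      ring
    rw [clearedSummand, Nat.add_sub_cancel_left, this]
    ring
  have hprod : ∏ k ∈ Finset.range n, (-p / p ^ n - d * p ^ (k + 1)) =
      (-p / p ^ n) ^ n * qPoch p (-(d * p ^ n)) n := by
    rw [qPoch, Finset.pow_eq_prod_const (-p / p ^ n), ← Finset.prod_mul_distrib]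
    refine Finset.prod_congr rfl fun k _ => ?_
    field_simp
    ring
  rw [Finset.sum_range_succ, Finset.sum_eq_zero hlast, zero_add, hprod, clearedSummand,
    qPoch_sq_div_mul_pow_self hp n hn, div_mul_cancel₀ _ (pow_ne_zero n hp),
    show d ^ 2 * (p ^ 2) ^ n = (d * p ^ n) ^ 2 by ring, qPoch_sq, Nat.sub_self]
  simp only [qPoch, mul_zero, Finset.range_zero, Finset.prod_empty]
  ring

theorem sum_clearedSummand_of_generic {n : ℕ} {p d : ℂ} (b : ℂ) (hp : p ≠ 0)
    (hn : qPoch (p ^ 2) (p ^ 2) n ≠ 0) (hd0 : d ≠ 0)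
    (hd : qPoch (p ^ 2) (d ^ 2) (2 * n + 1) ≠ 0) :
    ∑ j ∈ Finset.range (n + 1), clearedSummand n p b d j =
      qPoch p (-p) n * qPoch p (d * p ^ n) n *
        ∏ k ∈ Finset.range n, (b - d * p ^ (k + 1)) := by
  let F : Polynomial ℂ := ∑ j ∈ Finset.range (n + 1),
    Polynomial.C (qPoch (p ^ 2) ((p ^ 2) ^ (-(n : ℤ))) j / qPoch (p ^ 2) (p ^ 2) j *
      (p ^ 2) ^ j * (qPoch (p ^ 2) (d ^ 2 * (p ^ 2) ^ n) j *
        qPoch p (d * p * p ^ (2 * j)) (2 * (n - j)))) *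
      ((∏ i ∈ Finset.range j, (1 - Polynomial.C (p ^ j * p ^ i) * Polynomial.X)) *
        ∏ i ∈ Finset.range (n - j), (1 - Polynomial.C (-(p ^ j * p ^ i)) * Polynomial.X))
  let G : Polynomial ℂ := Polynomial.C (qPoch p (-p) n * qPoch p (d * p ^ n) n) *
    ∏ k ∈ Finset.range n, (Polynomial.X - Polynomial.C (d * p ^ (k + 1)))
  have hF (x : ℂ) : F.eval x = ∑ j ∈ Finset.range (n + 1), clearedSummand n p x d j := by
    simp only [F, Polynomial.eval_finsetSum]
    refine Finset.sum_congr rfl fun j _ => ?_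
    simp only [Polynomial.eval_mul, Polynomial.eval_prod, Polynomial.eval_sub,
      Polynomial.eval_one, Polynomial.eval_C, Polynomial.eval_X]
    have e1 : qPoch p (x * p ^ j) j = ∏ i ∈ Finset.range j, (1 - p ^ j * p ^ i * x) :=
      Finset.prod_congr rfl fun i _ => by ring
    have e2 : qPoch p (-x * p ^ j) (n - j) =
        ∏ i ∈ Finset.range (n - j), (1 - -(p ^ j * p ^ i) * x) :=
      Finset.prod_congr rfl fun i _ => by ring
    rw [clearedSummand, e1, e2]
    ring
  have hG (x : ℂ) : G.eval x = qPoch p (-p) n * qPoch p (d * p ^ n) n *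
      ∏ k ∈ Finset.range n, (x - d * p ^ (k + 1)) := by
    simp [G, Polynomial.eval_prod]
  have hFdeg : F.natDegree ≤ n := by
    refine Polynomial.natDegree_sum_le_of_forall_le _ _ fun j hj => ?_
    have hj : j ≤ n := by simpa [Nat.lt_succ_iff] using hj
    refine (Polynomial.natDegree_C_mul_le _ _).trans (Polynomial.natDegree_mul_le.trans ?_)
    exact (add_le_add (natDegree_prod_one_sub_C_mul_X_le _ _)
      (natDegree_prod_one_sub_C_mul_X_le _ _)).trans (by omega)
  have hGdeg : G.natDegree ≤ n := by
    refine (Polynomial.natDegree_C_mul_le _ _).trans ?_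
    rw [Polynomial.natDegree_finsetProd_X_sub_C_eq_card]
    simp
  let node : Fin (n + 1) → ℂ := Fin.cons (-p / p ^ n) fun k : Fin n => d * p ^ ((k : ℕ) + 1)
  have hpow (i : ℕ) (hi : i < n) : p ^ (i + 1) ≠ 1 := fun h => by
    refine qPoch_ne_zero_iff.1 hn i hi ?_
    rw [← pow_succ', ← pow_mul, mul_comm, pow_mul, h, one_pow]
  have hlt (k l : ℕ) (hkl : k < l) (hl : l < n) : d * p ^ (k + 1) ≠ d * p ^ (l + 1) := by
    intro h
    obtain ⟨i, rfl⟩ := Nat.exists_eq_add_of_lt hkl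
    refine hpow i (by omega) (mul_left_cancel₀ (mul_ne_zero hd0 (pow_ne_zero (k + 1) hp)) ?_)
    linear_combination -h
  have hinj : Function.Injective node := by
    refine Fin.cons_injective_iff.2 ⟨?_, fun k l h => ?_⟩
    · rintro ⟨k, hk⟩
      refine qPoch_ne_zero_iff.1 hd (n + k) (by omega) ?_
      have hk' : d * p ^ (n + (k : ℕ)) = -1 := by
        refine mul_left_cancel₀ hp ?_
        rw [eq_div_iff (pow_ne_zero n hp)] at hk
        linear_combination hk
      linear_combination (d * p ^ (n + (k : ℕ)) - 1) * hk'
    · rcases lt_trichotomy (k : ℕ) l with hkl | hkl | hkl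
      · exact absurd h (hlt k l hkl l.2)
      · exact Fin.ext hkl
      · exact absurd h.symm (hlt l k hkl k.2)
  have hzero : F - G = 0 := by
    refine Polynomial.eq_zero_of_natDegree_lt_card_of_eval_eq_zero _ hinj (fun i => ?_) ?_
    · rw [Polynomial.eval_sub, sub_eq_zero, hF, hG]
      refine Fin.cases ?_ (fun k => ?_) i
      · exact sum_clearedSummand_neg_div_pow d hp hn
      · simp only [node, Fin.cons_succ]
        rw [sum_clearedSummand_eq_zero hp hn hd k.2,
          Finset.prod_eq_zero (Finset.mem_range.2 k.2) (sub_self _), mul_zero]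
    · rw [Fintype.card_fin, Nat.lt_succ_iff]
      exact (Polynomial.natDegree_sub_le _ _).trans (max_le hFdeg hGdeg)
  rw [← hF, ← hG, sub_eq_zero.1 hzero]

theorem continuous_qPoch {f : ℂ → ℂ} (hf : Continuous f) (q : ℂ) (m : ℕ) :
    Continuous fun x => qPoch q (f x) m := by
  unfold qPoch
  fun_prop

/-- The identity with all denominators involving `b` and `d` cleared. -/
theorem sum_clearedSummand {n : ℕ} {p : ℂ} (b d : ℂ) (hp : p ≠ 0)
    (hn : qPoch (p ^ 2) (p ^ 2) n ≠ 0) :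
    ∑ j ∈ Finset.range (n + 1), clearedSummand n p b d j =
      qPoch p (-p) n * qPoch p (d * p ^ n) n *
        ∏ k ∈ Finset.range n, (b - d * p ^ (k + 1)) := by
  let Z : Polynomial ℂ := Polynomial.X * ∏ k ∈ Finset.range (2 * n + 1),
    (1 - Polynomial.X ^ 2 * Polynomial.C ((p ^ 2) ^ k))
  have hZeval (x : ℂ) : Z.eval x = x * qPoch (p ^ 2) (x ^ 2) (2 * n + 1) := by
    simp [Z, qPoch, Polynomial.eval_prod]
  have hZ : Z ≠ 0 := by
    refine mul_ne_zero Polynomial.X_ne_zero (Finset.prod_ne_zero_iff.2 fun k _ h => ?_)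
    simpa using congrArg (Polynomial.eval 0) h
  have hdense : Dense ((Z.roots.toFinset : Set ℂ)ᶜ) := Z.roots.toFinset.finite_toSet.countable.dense_compl ℂ
  refine congrFun (Continuous.ext_on (f := fun d => ∑ j ∈ Finset.range (n + 1),
    clearedSummand n p b d j) (g := fun d => qPoch p (-p) n * qPoch p (d * p ^ n) n *
      ∏ k ∈ Finset.range n, (b - d * p ^ (k + 1))) hdense ?_ ?_ fun x hx => ?_) d
  · unfold clearedSummand
    refine continuous_finsetSum _ fun j _ => continuous_const.mul ((Continuous.mul ?_ ?_).mul
      continuous_const) <;> exact continuous_qPoch (by fun_prop) _ _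
  · refine (continuous_const.mul (continuous_qPoch (by fun_prop) _ _)).mul ?_
    fun_prop
  · have hx : x * qPoch (p ^ 2) (x ^ 2) (2 * n + 1) ≠ 0 := by
      rw [← hZeval]
      simpa [hZ] using hx
    exact sum_clearedSummand_of_generic b hp hn (left_ne_zero_of_mul hx) (right_ne_zero_of_mul hx)

/-- First ${}_4\phi_3$ identity of Andrews and Li–Chu, with $q = p^2$. -/
theorem andrews_li_chu_first (n : ℕ) (p b d : ℂ) (hp : p ≠ 0) (hb : b ≠ 0)
    (h1 : qPoch (p ^ 2) (p ^ 2) n ≠ 0) (h2 : qPoch (p ^ 2) (d * p ^ 2) n ≠ 0)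
    (h3 : qPoch (p ^ 2) (d * p) n ≠ 0) (h4 : qPoch (p ^ 2) (b ^ 2) n ≠ 0)
    (h5 : qPoch p (-b) n ≠ 0) (h6 : qPoch p d n ≠ 0)
    (h7 : 1 - d * (p ^ 2) ^ n ≠ 0) :
    ∑ j ∈ Finset.range (n + 1),
      qPoch (p ^ 2) ((p ^ 2) ^ (-(n : ℤ))) j * qPoch (p ^ 2) b j * qPoch (p ^ 2) (b * p) j *
        qPoch (p ^ 2) (d ^ 2 * (p ^ 2) ^ n) j /
        (qPoch (p ^ 2) (p ^ 2) j * qPoch (p ^ 2) (d * p ^ 2) j * qPoch (p ^ 2) (d * p) j *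
          qPoch (p ^ 2) (b ^ 2) j) * (p ^ 2) ^ j
    = b ^ n * (1 - d) * qPoch p (-p) n * qPoch p (d * p / b) n /
        ((1 - d * (p ^ 2) ^ n) * qPoch p (-b) n * qPoch p d n) := by
  have hdp : qPoch p (d * p) (2 * n) ≠ 0 := by
    rw [qPoch_two_mul, show d * p * p = d * p ^ 2 by ring]
    exact mul_ne_zero h3 h2
  have key : ∀ j ∈ Finset.range (n + 1),
      qPoch (p ^ 2) ((p ^ 2) ^ (-(n : ℤ))) j * qPoch (p ^ 2) b j * qPoch (p ^ 2) (b * p) j *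
        qPoch (p ^ 2) (d ^ 2 * (p ^ 2) ^ n) j /
        (qPoch (p ^ 2) (p ^ 2) j * qPoch (p ^ 2) (d * p ^ 2) j * qPoch (p ^ 2) (d * p) j *
          qPoch (p ^ 2) (b ^ 2) j) * (p ^ 2) ^ j =
      clearedSummand n p b d j / (qPoch p (d * p) (2 * n) * qPoch p (-b) n) := by
    intro j hj
    have hj : j ≤ n := by simpa [Nat.lt_succ_iff] using hj
    have e1 := qPoch_sq_mul_shifted p b hj
    rw [qPoch_two_mul] at e1
    have e2 := qPoch_add p (d * p) (2 * j) (2 * (n - j))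
    rw [show 2 * j + 2 * (n - j) = 2 * n by omega, qPoch_two_mul p (d * p) j,
      show d * p * p = d * p ^ 2 by ring] at e2
    have g1 := qPoch_ne_zero_of_le h1 hj
    have g2 := qPoch_ne_zero_of_le h2 hj
    have g3 := qPoch_ne_zero_of_le h3 hj
    have g4 := qPoch_ne_zero_of_le h4 hj
    rw [eq_div_iff (mul_ne_zero hdp h5), clearedSummand, e2]
    generalize qPoch p (b * p ^ j) j * qPoch p (-b * p ^ j) (n - j) = y at *
    generalize qPoch (p ^ 2) (d * p ^ 2) j = x1 at *
    generalize qPoch (p ^ 2) (d * p) j = x2 at *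
    generalize qPoch p (d * p * p ^ (2 * j)) (2 * (n - j)) = x3 at *
    generalize qPoch (p ^ 2) (b * p) j = x4 at *
    field_simp
    linear_combination -qPoch (p ^ 2) ((p ^ 2) ^ (-(n : ℤ))) j *
      qPoch (p ^ 2) (d ^ 2 * (p ^ 2) ^ n) j * x3 * e1
  rw [Finset.sum_congr rfl key, ← Finset.sum_div, sum_clearedSummand b d hp h1,
    div_eq_div_iff (mul_ne_zero hdp h5) (mul_ne_zero (mul_ne_zero h7 h5) h6)]
  have hb' : ∏ k ∈ Finset.range n, (b - d * p ^ (k + 1)) = b ^ n * qPoch p (d * p / b) n := by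
    rw [qPoch, Finset.pow_eq_prod_const b, ← Finset.prod_mul_distrib]
    refine Finset.prod_congr rfl fun k _ => ?_
    field_simp
    ring
  have hd' : qPoch p d n * qPoch p (d * p ^ n) n * (1 - d * (p ^ 2) ^ n) =
      (1 - d) * qPoch p (d * p) (2 * n) := by
    rw [← qPoch_succ', qPoch_succ, ← qPoch_add, ← pow_mul, two_mul]
  rw [hb']
  linear_combination qPoch p (-p) n * (b ^ n * qPoch p (d * p / b) n) * qPoch p (-b) n * hd'
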